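/- arXiv:1602.00276 — 7 statements merged into one kernel-verified Lean document; each statement's English description precedes it below -/
import Mathlib

section
/- Let q ≥ 2 be an integer. For every real x ∈ [0, 1 − 1/q] and every real δ ∈ (0, 1/2) with x + δ ≤ 1, one has H_q(x + δ) < H_q(x) + (2·√δ + δ·ln(q−1))/ln q. -/
/-- The `q`-ary entropy function `H_q(x) = x·log_q(q−1) − x·log_q x − (1−x)·log_q(1−x)`,
with the convention `0·log_q 0 = 0` (automatic since `Real.logb q 0 = 0`). -/
noncomputable def qEnt (q : ℕ) (x : ℝ) : ℝ :=
  x * Real.logb q (q - 1) - x * Real.logb q x - (1 - x) * Real.logb q (1 - x)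

theorem qEnt_eq_div_log (q : ℕ) (x : ℝ) :
    qEnt q x = (x * Real.log ((q : ℝ) - 1) + Real.negMulLog x + Real.negMulLog (1 - x)) /
      Real.log q := by
  simp only [qEnt, Real.logb, Real.negMulLog]
  ring

theorem negMulLog_add_le {x y : ℝ} (hx : 0 ≤ x) (hy : 0 < y) :
    Real.negMulLog (x + y) ≤ Real.negMulLog x + Real.negMulLog y := by
  have h₁ : x * Real.log x ≤ x * Real.log (x + y) := by
    rcases hx.eq_or_lt with rfl | hx
    · simp
    · exact mul_le_mul_of_nonneg_left (Real.log_le_log hx (by linarith)) hx.le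
  have h₂ : y * Real.log y ≤ y * Real.log (x + y) :=
    mul_le_mul_of_nonneg_left (Real.log_le_log hy (by linarith)) hy.le
  simp only [Real.negMulLog]
  linarith

theorem negMulLog_le_negMulLog_add_add {y t : ℝ} (hy : 0 ≤ y) (ht : 0 < t) (hyt : y + t ≤ 1) :
    Real.negMulLog y ≤ Real.negMulLog (y + t) + t := by
  have h₁ : t * Real.log (y + t) ≤ 0 :=
    mul_nonpos_of_nonneg_of_nonpos ht.le (Real.log_nonpos (by linarith) hyt)
  have h₂ : y * Real.log (y + t) ≤ y * Real.log y + t := by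
    rcases hy.eq_or_lt with rfl | hy
    · simpa using ht.le
    · have hlog := Real.log_le_sub_one_of_pos (div_pos (add_pos hy ht) hy)
      rw [Real.log_div (by positivity) hy.ne'] at hlog
      have hmul := mul_le_mul_of_nonneg_left hlog hy.le
      have hcancel : y * ((y + t) / y - 1) = t := by
        field_simp
        ring
      linarith
  simp only [Real.negMulLog]
  linarith

theorem negMulLog_le_two_mul_sqrt_sub {t : ℝ} (ht : 0 < t) :
    Real.negMulLog t ≤ 2 * Real.sqrt t - 2 * t := by
  have hs : 0 < Real.sqrt t := Real.sqrt_pos.2 ht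
  have hlog := Real.one_sub_inv_le_log_of_pos hs
  rw [Real.log_sqrt ht.le] at hlog
  have hmul := mul_le_mul_of_nonneg_left hlog ht.le
  have hcancel : t * (1 - (Real.sqrt t)⁻¹) = t - Real.sqrt t := by
    rw [mul_sub, mul_one, ← div_eq_mul_inv, Real.div_sqrt]
  simp only [Real.negMulLog]
  linarith

theorem stmt0 (q : ℕ) (hq : 2 ≤ q) (x δ : ℝ)
    (hx0 : 0 ≤ x) (hx1 : x ≤ 1 - 1 / (q : ℝ))
    (hδ0 : 0 < δ) (hδ1 : δ < 1 / 2) (hxδ : x + δ ≤ 1) :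
    qEnt q (x + δ) < qEnt q x + (2 * Real.sqrt δ + δ * Real.log ((q : ℝ) - 1)) / Real.log q := by
  have hlogq : 0 < Real.log q := Real.log_pos (by exact_mod_cast hq)
  rw [qEnt_eq_div_log, qEnt_eq_div_log, ← add_div]
  refine div_lt_div_of_pos_right ?_ hlogq
  have h₁ := negMulLog_add_le hx0 hδ0
  have h₂ := negMulLog_le_negMulLog_add_add (y := 1 - (x + δ)) (by linarith) hδ0 (by linarith)
  rw [show 1 - (x + δ) + δ = 1 - x by ring] at h₂
  have h₃ := negMulLog_le_two_mul_sqrt_sub hδ0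
  linarith
end

section
/- Let C = min_{p̄ ∈ [0,p]} [ α_q(p̄)·(1 − H_q(p̄/α_q(p̄))) ] and R = C − ε. Then for every real t ∈ (0, n) and every real λ ∈ [0, min(t, n·p⋆)] such that t − λ ∈ [ n·(1 − (2q/(q−1))·p − (q/(q−1))·p⋆ − ε²/4), n·(1 − (q/(q−1))·p⋆) ], there exists p̂ ∈ [0, 1 − 1/q] satisfying both (t−λ)·(1 − H_q(p̂)) − n·ε/4 ≥ n·R (the list-decoding condition) and n·p − (t−λ)·p̂ + (n−t)·ε²/(9q²) ≤ ((q−1)/(2q))·(n − n·p⋆ − t + λ) (the energy bounding condition). -/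
/-- `α_q(p̄) = 1 − (2q/(q−1))(p−p̄) − (q/(q−1))p⋆`. -/
noncomputable def alphaq (q : ℕ) (p pstar pbar : ℝ) : ℝ :=
  1 - (2 * q / ((q : ℝ) - 1)) * (p - pbar) - ((q : ℝ) / ((q : ℝ) - 1)) * pstar

lemma qEnt_eq_qaryEntropy_div_log (q : ℕ) (x : ℝ) :
    qEnt q x = Real.qaryEntropy q x / Real.log q := by
  simp only [qEnt, Real.qaryEntropy, Real.binEntropy, Real.logb, Real.log_inv]
  push_cast
  ring

lemma continuous_qEnt (q : ℕ) : Continuous (qEnt q) := by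
  rw [funext (qEnt_eq_qaryEntropy_div_log q)]
  exact Real.qaryEntropy_continuous.div_const _

lemma qEnt_zero (q : ℕ) : qEnt q 0 = 0 := by
  simp [qEnt]

lemma mul_qEnt_le_qEnt_mul (q : ℕ) {c y : ℝ} (hc0 : 0 ≤ c) (hc1 : c ≤ 1)
    (hy0 : 0 ≤ y) (hy1 : y ≤ 1) : c * qEnt q y ≤ qEnt q (c * y) := by
  have hconc := (Real.strictConcaveOn_qaryEntropy (q := q)).concaveOn
  have h := hconc.2 (x := y) (y := 0) ⟨hy0, hy1⟩ ⟨le_rfl, zero_le_one⟩ hc0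
    (sub_nonneg.2 hc1) (by ring)
  simp only [smul_eq_mul, mul_zero, add_zero, Real.qaryEntropy_zero] at h
  rw [qEnt_eq_qaryEntropy_div_log, qEnt_eq_qaryEntropy_div_log, ← mul_div_assoc]
  exact div_le_div_of_nonneg_right h (Real.log_natCast_nonneg q)

lemma qEnt_add_le (q : ℕ) {x y : ℝ} (hx : 0 ≤ x) (hy : 0 < y)
    (hxy : x + y ≤ 1) : qEnt q (x + y) ≤ qEnt q x + qEnt q y := by
  have hpos : 0 < x + y := by linarith
  have h1 := mul_qEnt_le_qEnt_mul q (c := x / (x + y)) (y := x + y) (by positivity)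
    ((div_le_one hpos).2 (by linarith)) hpos.le hxy
  have h2 := mul_qEnt_le_qEnt_mul q (c := y / (x + y)) (y := x + y) (by positivity)
    ((div_le_one hpos).2 (by linarith)) hpos.le hxy
  rw [div_mul_cancel₀ _ hpos.ne'] at h1 h2
  have h3 : x / (x + y) * qEnt q (x + y) + y / (x + y) * qEnt q (x + y) = qEnt q (x + y) := by
    field_simp
  linarith

lemma qEnt_sq_le {q : ℕ} (hq : 2 ≤ q) {u : ℝ} (hu0 : 0 < u) (hu1 : u ≤ 1 / 6) :
    qEnt q (u ^ 2) ≤ 3 * q * u / 2 := by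
  have hq' : (2 : ℝ) ≤ q := by exact_mod_cast hq
  have hlog : 0.69 ≤ Real.log q :=
    (by linarith [Real.log_two_gt_d9] : (0.69 : ℝ) ≤ Real.log 2).trans
      (Real.log_le_log (by norm_num) hq')
  have hlog' : Real.log ((q : ℝ) - 1) ≤ Real.log q :=
    Real.log_le_log (by linarith) (by linarith)
  have hu2 : u ^ 2 < 1 := by nlinarith
  have h1 : Real.log u⁻¹ ≤ u⁻¹ - 1 := Real.log_le_sub_one_of_pos (by positivity)
  have h2 : Real.log (1 - u ^ 2)⁻¹ ≤ (1 - u ^ 2)⁻¹ - 1 :=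
    Real.log_le_sub_one_of_pos (inv_pos.2 (by linarith))
  have h1' : u ^ 2 * Real.log (u ^ 2)⁻¹ ≤ 2 * u - 2 * u ^ 2 := by
    have : Real.log (u ^ 2)⁻¹ = 2 * Real.log u⁻¹ := by
      rw [← inv_pow, Real.log_pow]; norm_num
    rw [this]
    calc u ^ 2 * (2 * Real.log u⁻¹) ≤ u ^ 2 * (2 * (u⁻¹ - 1)) := by gcongr
      _ = _ := by field_simp
  have h2' : (1 - u ^ 2) * Real.log (1 - u ^ 2)⁻¹ ≤ u ^ 2 := by
    calc _ ≤ (1 - u ^ 2) * ((1 - u ^ 2)⁻¹ - 1) :=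
          mul_le_mul_of_nonneg_left h2 (by linarith)
      _ = 1 - (1 - u ^ 2) := by rw [mul_sub, mul_inv_cancel₀ (by linarith), mul_one]
      _ = _ := by ring
  rw [qEnt_eq_qaryEntropy_div_log, div_le_iff₀ (by linarith)]
  simp only [Real.qaryEntropy, Real.binEntropy]
  push_cast
  have h3 : u ^ 2 * Real.log ((q : ℝ) - 1) ≤ u ^ 2 * Real.log q := by gcongr
  have h4 : 2 - u ≤ (3 * q / 2 - u) * Real.log q := by nlinarith
  nlinarith [mul_le_mul_of_nonneg_left h4 hu0.le]

/-- The cost, in entropy scaled by `s`, of raising the argument `m / s` to `(m + u ^ 2) / s`. -/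
lemma mul_qEnt_add_sq_div_le {q : ℕ} (hq : 2 ≤ q) {s m u : ℝ} (hs0 : 0 < s) (hs1 : s ≤ 1)
    (hm : 0 ≤ m) (hu0 : 0 < u) (hu1 : u ≤ 1 / 6) (hms : m + u ^ 2 ≤ s) :
    s * qEnt q ((m + u ^ 2) / s) ≤ s * qEnt q (m / s) + 3 * q * u / 2 := by
  have hsub := qEnt_add_le q (x := m / s) (y := u ^ 2 / s) (by positivity) (by positivity)
    (by rw [← add_div]; exact (div_le_one hs0).2 hms)
  have hscale := mul_qEnt_le_qEnt_mul q (c := s) (y := u ^ 2 / s) hs0.le hs1 (by positivity)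
    ((div_le_one hs0).2 (by linarith))
  rw [mul_div_cancel₀ _ hs0.ne'] at hscale
  rw [add_div]
  linarith [mul_le_mul_of_nonneg_left hsub hs0.le, qEnt_sq_le hq hu0 hu1]

lemma bddBelow_alphaq_mul_one_sub_qEnt {q : ℕ} (hq : 2 ≤ q) {p pstar : ℝ}
    (h : 2 * p + pstar < ((q : ℝ) - 1) / q) :
    BddBelow ((fun pbar =>
      alphaq q p pstar pbar * (1 - qEnt q (pbar / alphaq q p pstar pbar))) '' Set.Icc 0 p) := by
  have hq' : (2 : ℝ) ≤ q := by exact_mod_cast hq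
  have hq1 : (0 : ℝ) < q - 1 := by linarith
  have hα : ∀ x ∈ Set.Icc (0 : ℝ) p, alphaq q p pstar x ≠ 0 := by
    intro x hx
    have : alphaq q p pstar x = q / (q - 1) * ((q - 1) / q - 2 * p - pstar + 2 * x) := by
      unfold alphaq; field_simp; ring
    rw [this]
    have := hx.1
    exact (mul_pos (by positivity) (by linarith)).ne'
  have hαc : Continuous (alphaq q p pstar) := by unfold alphaq; fun_prop
  apply isCompact_Icc.bddBelow_image
  exact hαc.continuousOn.mul (continuousOn_const.sub
    ((continuous_qEnt q).comp_continuousOn (continuousOn_id.div hαc.continuousOn hα)))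

theorem stmt7 (q : ℕ) (hq : 2 ≤ q) (ε p pstar n : ℝ)
    (hε0 : 0 < ε) (hε1 : ε < 1)
    (hp0 : 0 < p) (hp1 : p < ((q : ℝ) - 1) / (2 * q))
    (hps0 : 0 < pstar) (hps1 : pstar < ((q : ℝ) - 1) / q)
    (hsum : 2 * p + pstar + ε ≤ ((q : ℝ) - 1) / q)
    (hn : 0 < n)
    (C R : ℝ)
    (hC : C = sInf ((fun pbar =>
      alphaq q p pstar pbar * (1 - qEnt q (pbar / alphaq q p pstar pbar))) '' Set.Icc 0 p))
    (hR : R = C - ε) :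
    ∀ t lam : ℝ, 0 < t → t < n → 0 ≤ lam → lam ≤ min t (n * pstar) →
      t - lam ∈ Set.Icc
        (n * (1 - (2 * q / ((q : ℝ) - 1)) * p - ((q : ℝ) / ((q : ℝ) - 1)) * pstar - ε ^ 2 / 4))
        (n * (1 - ((q : ℝ) / ((q : ℝ) - 1)) * pstar)) →
      ∃ phat ∈ Set.Icc (0 : ℝ) (1 - 1 / (q : ℝ)),
        (t - lam) * (1 - qEnt q phat) - n * ε / 4 ≥ n * R ∧
        n * p - (t - lam) * phat + (n - t) * ε ^ 2 / (9 * (q : ℝ) ^ 2) ≤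
          (((q : ℝ) - 1) / (2 * q)) * (n - n * pstar - t + lam) := by
  intro t lam ht0 htn hlam0 hlam hmem
  obtain ⟨hlo, hhi⟩ := hmem
  have hq' : (2 : ℝ) ≤ q := by exact_mod_cast hq
  have hq1 : (0 : ℝ) < q - 1 := by linarith
  obtain ⟨s, hs⟩ : ∃ s, t - lam = n * s := ⟨(t - lam) / n, by field_simp⟩
  obtain ⟨b, hb⟩ : ∃ b : ℝ, b = ((q : ℝ) - 1) / q := ⟨_, rfl⟩
  have hb0 : 1 / 2 ≤ b := by rw [hb, div_le_div_iff₀ (by norm_num) (by linarith)]; linarith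
  have hb1 : b ≤ 1 := by rw [hb, div_le_one (by linarith)]; linarith
  have hab : (q : ℝ) / (q - 1) * b = 1 := by rw [hb]; field_simp
  have ha : (q : ℝ) / (q - 1) = b⁻¹ := eq_inv_of_mul_eq_one_left hab
  have h2a : 2 * (q : ℝ) / (q - 1) = 2 * b⁻¹ := by rw [← ha]; ring
  have hbinv : b * b⁻¹ = 1 := by rw [← ha, mul_comm]; exact hab
  have hα : ∀ x, b * alphaq q p pstar x = b - 2 * (p - x) - pstar := by
    intro x
    simp only [alphaq, ha, h2a]
    linear_combination (-2 * (p - x) - pstar) * hbinv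
  have hbdd := bddBelow_alphaq_mul_one_sub_qEnt hq (p := p) (pstar := pstar) (by linarith)
  rw [hs] at hlo hhi
  have hlo' := mul_le_mul_of_nonneg_left (le_of_mul_le_mul_left hlo hn) (by linarith : 0 ≤ b)
  have hhi' := mul_le_mul_of_nonneg_left (le_of_mul_le_mul_left hhi hn) (by linarith : 0 ≤ b)
  rw [h2a, ha] at hlo'
  rw [ha] at hhi'
  have hlo2 : b - 2 * p - pstar - b * ε ^ 2 / 4 ≤ b * s := by
    linear_combination hlo' + (2 * p + pstar) * hbinv
  have hhi2 : b * s ≤ b - pstar := by linear_combination hhi' - pstar * hbinv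
  rw [← hb] at hsum
  have hε2 : ε ^ 2 ≤ ε := by nlinarith
  have hbε : b * ε ^ 2 ≤ ε := by
    linarith [mul_le_mul_of_nonneg_right hb1 (sq_nonneg ε)]
  have hbs : 3 * ε / 4 ≤ b * s := by linarith
  have hs0 : 0 < s := pos_of_mul_pos_right (by linarith : 0 < b * s) (by linarith)
  have hs1 : s ≤ 1 := le_of_mul_le_mul_left (by linarith : b * s ≤ b * 1) (by linarith)
  obtain ⟨u, hu⟩ : ∃ u, u = ε / (3 * q) := ⟨_, rfl⟩
  have hqu : 3 * q * u = ε := by rw [hu]; field_simp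
  have hu0 : 0 < u := by rw [hu]; positivity
  have hu6 : u ≤ ε / 6 := by linarith [mul_le_mul_of_nonneg_right hq' hu0.le]
  have hθ : (n - t) * ε ^ 2 / (9 * (q : ℝ) ^ 2) = (n - t) * u ^ 2 := by
    rw [hu]; field_simp; ring
  have hu2 : u ^ 2 ≤ ε / 4 := by
    linarith [mul_le_mul_of_nonneg_left (by linarith : u ≤ 1) hu0.le, sq u]
  -- `pbar` is the solution of `alphaq q p pstar pbar = s`
  obtain ⟨pbar, hpbar⟩ : ∃ x, x = p - (b - pstar - b * s) / 2 := ⟨_, rfl⟩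
  have key : ∃ m, 0 ≤ m ∧ pbar ≤ m ∧ m + u ^ 2 ≤ b * s ∧
      C - ε / 4 ≤ s * (1 - qEnt q (m / s)) := by
    rcases le_total 0 pbar with h | h
    · refine ⟨pbar, h, le_rfl, by linarith, ?_⟩
      have hαs : alphaq q p pstar pbar = s := by
        apply mul_left_cancel₀ (by linarith : b ≠ 0)
        rw [hα, hpbar]; ring
      have hCle := csInf_le hbdd (Set.mem_image_of_mem _ (⟨h, by linarith⟩ : pbar ∈ Set.Icc 0 p))
      simp only [hαs] at hCle
      linarith
    · refine ⟨0, le_rfl, h, by linarith, ?_⟩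
      have hCle := csInf_le hbdd (Set.mem_image_of_mem _ (⟨le_rfl, hp0.le⟩ : (0 : ℝ) ∈ Set.Icc 0 p))
      simp only [zero_div, qEnt_zero, sub_zero, mul_one] at hCle ⊢
      have h0 := hα 0
      have : alphaq q p pstar 0 ≤ s + ε ^ 2 / 4 :=
        le_of_mul_le_mul_left (by linarith) (by linarith : 0 < b)
      linarith
  obtain ⟨m, hm0, hm, hmb, hCm⟩ := key
  have hms : m + u ^ 2 ≤ s := by linarith [mul_le_mul_of_nonneg_right hb1 hs0.le]
  have hent := mul_qEnt_add_sq_div_le hq hs0 hs1 hm0 hu0 (by linarith) hms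
  refine ⟨(m + u ^ 2) / s, ⟨by positivity, ?_⟩, ?_, ?_⟩
  · have : 1 - 1 / (q : ℝ) = b := by rw [hb]; field_simp
    rwa [this, div_le_iff₀ hs0]
  · rw [hs, hR]
    have : C - ε ≤ s * (1 - qEnt q ((m + u ^ 2) / s)) - ε / 4 := by linarith
    linear_combination n * this
  · have h2b : ((q : ℝ) - 1) / (2 * q) = b / 2 := by rw [hb]; field_simp
    have hsp : n * s * ((m + u ^ 2) / s) = n * (m + u ^ 2) := by field_simp
    rw [hθ, hs, hsp, h2b]
    have htu : 0 ≤ t * u ^ 2 := by positivity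
    have hbp : b * pstar ≤ pstar := mul_le_of_le_one_left hps0.le hb1
    have : p - m ≤ b / 2 * (1 - pstar - s) := by linarith
    linear_combination n * this + htu + b / 2 * hs
end

section
/- If t ∈ (0, n) and λ_t ∈ [0, n·p⋆] satisfy t − λ_t = n − (q/(q−1))·n·p⋆ − n·θ, then (t − λ_t)·p̂_t ≥ n·p. -/
/-- Bob's guess of random noise `p̄_t`, expressed through `m = t − λ_t`:
`p̄_t = p + p⋆/2 − ((q−1)/(2q))·(1 − m/n)`. -/
noncomputable def pbarT (q : ℕ) (p pstar n m : ℝ) : ℝ :=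
  p + pstar / 2 - (((q : ℝ) - 1) / (2 * q)) * (1 - m / n)

/-- Bob's decoding reference trajectory `p̂_t`, expressed through `m = t − λ_t`:
equal to `ε²/(9q²·α_q(0)²)` for `m < n·α_q(0)` and to
`p̄_t/α_q(p̄_t) + ε²/(9q²·α_q(p̄_t)²)` for `m ≥ n·α_q(0)`. -/
noncomputable def phatT (q : ℕ) (p pstar ε n m : ℝ) : ℝ :=
  if m < n * alphaq q p pstar 0 then
    ε ^ 2 / (9 * (q : ℝ) ^ 2 * (alphaq q p pstar 0) ^ 2)
  else
    pbarT q p pstar n m / alphaq q p pstar (pbarT q p pstar n m) +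
      ε ^ 2 / (9 * (q : ℝ) ^ 2 * (alphaq q p pstar (pbarT q p pstar n m)) ^ 2)

/-- The energy bounding trajectory `p̃_t = p̄_t/α_q(p̄_t) + (n−t)·ε²/(9q²·m)`,
expressed through the position `t` and `m = t − λ_t`. -/
noncomputable def ptildeT (q : ℕ) (p pstar ε n t m : ℝ) : ℝ :=
  pbarT q p pstar n m / alphaq q p pstar (pbarT q p pstar n m) +
    (n - t) * ε ^ 2 / (9 * (q : ℝ) ^ 2 * m)

theorem stmt8 (q : ℕ) (hq : 2 ≤ q) (ε p pstar n : ℝ)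
    (hε0 : 0 < ε) (hε1 : ε < 1)
    (hp0 : 0 < p) (hp1 : p < ((q : ℝ) - 1) / (2 * q))
    (hps0 : 0 < pstar) (hps1 : pstar < ((q : ℝ) - 1) / q)
    (hsum : 2 * p + pstar + ε ≤ ((q : ℝ) - 1) / q)
    (hn : 0 < n)
    (θ : ℝ) (hθ : θ = ε ^ 2 / (9 * (q : ℝ) ^ 2))
    (t lam : ℝ) (ht0 : 0 < t) (ht1 : t < n)
    (hl0 : 0 ≤ lam) (hl1 : lam ≤ n * pstar)
    (hm : t - lam = n - ((q : ℝ) / ((q : ℝ) - 1)) * n * pstar - n * θ) :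
    (t - lam) * phatT q p pstar ε n (t - lam) ≥ n * p := by
  have hq2 : (2 : ℝ) ≤ q := by exact_mod_cast hq
  have hq1 : (0 : ℝ) < (q : ℝ) - 1 := by linarith
  obtain ⟨c, hc⟩ : ∃ c : ℝ, c = (q : ℝ) / ((q : ℝ) - 1) := ⟨_, rfl⟩
  have hc1 : 1 < c := by rw [hc, lt_div_iff₀ hq1]; linarith
  have hc0 : 0 < c := by linarith
  have hcinv : ((q : ℝ) - 1) / q = 1 / c := by rw [hc, one_div_div]
  have h2c : 2 * (q : ℝ) / ((q : ℝ) - 1) = 2 * c := by rw [hc]; ring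
  have hc2 : ((q : ℝ) - 1) / (2 * q) = 1 / (2 * c) := by
    rw [hc]; field_simp
  have hs : c * (2 * p + pstar + ε) ≤ 1 := by
    rw [hcinv, le_div_iff₀ hc0] at hsum
    linarith
  have hθ0 : 0 < θ := by rw [hθ]; positivity
  have hθε : 36 * θ ≤ ε ^ 2 := by
    have hq4 : (4 : ℝ) ≤ (q : ℝ) ^ 2 := by nlinarith
    have hθq : θ * (9 * (q : ℝ) ^ 2) = ε ^ 2 := by
      rw [hθ]; field_simp
    nlinarith
  have hεε : ε ^ 2 < ε := by nlinarith
  have hcε : ε < c * ε := lt_mul_of_one_lt_left hε0 hc1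
  have hcp : p < c * p := lt_mul_of_one_lt_left hp0 hc1
  have hcps : 0 < c * pstar := by positivity
  obtain ⟨a, ha⟩ : ∃ a : ℝ, a = 1 - c * pstar - θ := ⟨_, rfl⟩
  have hcp0 : 0 < c * p := by positivity
  have ha0 : 0 < a := by linarith
  have ha1 : a ≤ 1 := by linarith
  have hma : t - lam = n * a := by rw [hm, ← hc, ha]; ring
  have hα0 : alphaq q p pstar 0 = 1 - 2 * c * p - c * pstar := by
    rw [alphaq, h2c, ← hc, sub_zero]
  have hpbar : pbarT q p pstar n (n * a) = p - θ / (2 * c) := by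
    rw [pbarT, hc2, mul_div_cancel_left₀ _ hn.ne', ha]
    field_simp
    ring
  have hα : alphaq q p pstar (p - θ / (2 * c)) = a := by
    rw [alphaq, h2c, ← hc, ha]
    field_simp
    ring
  have hdiv (x : ℝ) : ε ^ 2 / (9 * (q : ℝ) ^ 2 * x) = θ / x := by
    rw [hθ, div_div]
  rw [hma, phatT, hpbar, hα, hdiv, hdiv, hα0, ge_iff_le, mul_assoc]
  refine mul_le_mul_of_nonneg_left ?_ hn.le
  obtain ⟨b, hb⟩ : ∃ b : ℝ, b = 1 - 2 * c * p - c * pstar := ⟨_, rfl⟩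
  have hb0 : ε < b := by linarith
  have hb1 : b ≤ 1 := by linarith
  rw [← hb]
  split_ifs with hlt
  · have hab : a < b := lt_of_mul_lt_mul_left hlt hn.le
    have hpθ : 2 * p ≤ θ := by linarith
    have hba : b ≤ 2 * a := by linarith
    have hb2 : b ^ 2 ≤ 2 * a := (pow_le_of_le_one (by linarith) hb1 two_ne_zero).trans hba
    rw [← mul_div_assoc, le_div_iff₀ (pow_pos (hε0.trans hb0) 2)]
    calc p * b ^ 2 ≤ p * (2 * a) := mul_le_mul_of_nonneg_left hb2 hp0.le
      _ = a * (2 * p) := by ring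
      _ ≤ a * θ := mul_le_mul_of_nonneg_left hpθ ha0.le
  · have hexp : a * ((p - θ / (2 * c)) / a + θ / a ^ 2) = p - θ / (2 * c) + θ / a := by
      field_simp
    have h1 : θ / (2 * c) ≤ θ := div_le_self hθ0.le (by linarith)
    have h2 : θ ≤ θ / a := le_div_self hθ0.le ha0 ha1
    rw [hexp]
    linarith
end

section
/- Suppose t, λ_{t−nθ}, λ_t, p_{t−nθ}, p_t are reals with nθ < t < n, 0 ≤ λ_{t−nθ} ≤ λ_t ≤ λ_{t−nθ} + nθ, λ_t ≤ n·p⋆, (t−nθ) − λ_{t−nθ} ≥ n·(α_q(0) − ε²/4), and t − λ_t ∈ [ n·(α_q(0) − ε²/4) + nθ, n·(1 − (q/(q−1))·p⋆) ]. If the cumulative error mass is nondecreasing, i.e. (t − λ_t)·p_t ≥ ((t−nθ) − λ_{t−nθ})·p_{t−nθ}, and p_{t−nθ} > p̂_{t−nθ}, then p_t > p̃_t. -/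
/-- The rate identity `α_q(p̄) = m/n`. -/
lemma alphaq_pbarT {q : ℕ} (hq : 2 ≤ q) (p pstar n m : ℝ) :
    alphaq q p pstar (pbarT q p pstar n m) = m / n := by
  have hq2 : (2 : ℝ) ≤ q := by exact_mod_cast hq
  have h1 : (q : ℝ) - 1 ≠ 0 := by linarith
  have h2 : (q : ℝ) ≠ 0 := by linarith
  unfold alphaq pbarT
  generalize m / n = x
  field_simp
  ring

lemma pbarT_eq {q : ℕ} (hq : 2 ≤ q) (p pstar n m : ℝ) :
    pbarT q p pstar n m = ((q : ℝ) - 1) / (2 * q) * (m / n - alphaq q p pstar 0) := by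
  have hq2 : (2 : ℝ) ≤ q := by exact_mod_cast hq
  have h1 : (q : ℝ) - 1 ≠ 0 := by linarith
  have h2 : (q : ℝ) ≠ 0 := by linarith
  unfold alphaq pbarT
  generalize m / n = x
  field_simp
  ring

lemma lt_alphaq_zero {q : ℕ} (hq : 2 ≤ q) {ε p pstar : ℝ} (hε : 0 < ε)
    (hsum : 2 * p + pstar + ε ≤ ((q : ℝ) - 1) / q) : ε < alphaq q p pstar 0 := by
  have hq2 : (2 : ℝ) ≤ q := by exact_mod_cast hq
  have h1 : 0 < (q : ℝ) - 1 := by linarith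
  rw [le_div_iff₀ (by linarith)] at hsum
  have h : alphaq q p pstar 0 = (q - 1 - q * (2 * p + pstar)) / ((q : ℝ) - 1) := by
    unfold alphaq
    field_simp
    ring
  rw [h, lt_div_iff₀ h1]
  nlinarith

lemma alphaq_zero_le_one {q : ℕ} (hq : 2 ≤ q) {p pstar : ℝ} (hp : 0 ≤ p) (hps : 0 ≤ pstar) :
    alphaq q p pstar 0 ≤ 1 := by
  have hq2 : (2 : ℝ) ≤ q := by exact_mod_cast hq
  have h1 : 0 < (q : ℝ) - 1 := by linarith
  have h2 : 0 ≤ 2 * (q : ℝ) / (q - 1) * (p - 0) := by rw [sub_zero]; positivity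
  have h3 : 0 ≤ (q : ℝ) / (q - 1) * pstar := by positivity
  unfold alphaq
  linarith

/-- Growth of the energy bound over one step, before the reference rate `a` is reached. -/
lemma energy_le_of_lt {a c ε θ τ x y : ℝ} (hε : 0 < ε) (hεa : ε ≤ a) (ha1 : a ≤ 1)
    (hc0 : 0 ≤ c) (hc : c ≤ 1 / 2) (hθ : 0 ≤ θ) (hy : a - ε ^ 2 / 4 ≤ y) (hya : y < a)
    (hxy : x ≤ y + θ) (hτ : y ≤ τ) :
    c * (x - a) + (1 - τ) * θ ≤ y * (θ / a ^ 2) := by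
  have ha : 0 < a := by linarith
  have hsq : ε ^ 2 ≤ a ^ 2 := by gcongr
  have hy' : a - a ^ 2 / 4 ≤ y := by linarith
  have key : 1 / 2 + (1 - y) ≤ y / a ^ 2 := by
    rw [le_div_iff₀ (by positivity)]
    have h1 : (a - a ^ 2 / 4) * (1 + a ^ 2) ≤ y * (1 + a ^ 2) := by gcongr
    have h2 : 0 ≤ a * ((1 - a) * (1 - 3 / 4 * a + a ^ 2 / 4)) :=
      mul_nonneg ha.le (mul_nonneg (by linarith) (by nlinarith))
    nlinarith
  have h1 : c * (x - a) ≤ 1 / 2 * θ :=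
    (mul_le_mul_of_nonneg_left (by linarith) hc0).trans (mul_le_mul_of_nonneg_right hc hθ)
  have h2 : (1 - τ) * θ ≤ (1 - y) * θ := by gcongr
  have h3 := mul_le_mul_of_nonneg_right key hθ
  have h4 : y * (θ / a ^ 2) = y / a ^ 2 * θ := by ring
  linarith

/-- Growth of the energy bound over one step, after the reference rate `a` is reached. -/
lemma energy_le_of_pos {a c θ τ x y : ℝ} (hy : 0 < y) (hc0 : 0 ≤ c) (hc : c ≤ 1 / 2)
    (hθ : 0 ≤ θ) (hxy : x ≤ y + θ) (hτ : y ≤ τ) :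
    c * (x - a) + (1 - τ) * θ ≤ y * (c * (y - a) / y + θ / y ^ 2) := by
  have key : 1 / 2 + (1 - y) ≤ 1 / y := by
    rw [le_div_iff₀ hy]
    nlinarith [sq_nonneg (y - 3 / 4)]
  have h1 : c * (x - y) ≤ 1 / 2 * θ :=
    (mul_le_mul_of_nonneg_left (by linarith) hc0).trans (mul_le_mul_of_nonneg_right hc hθ)
  have h2 : (1 - τ) * θ ≤ (1 - y) * θ := by gcongr
  have h3 := mul_le_mul_of_nonneg_right key hθ
  have h4 : y * (c * (y - a) / y + θ / y ^ 2) = c * (y - a) + 1 / y * θ := by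
    field_simp
  linarith

theorem stmt9 (q : ℕ) (hq : 2 ≤ q) (ε p pstar n : ℝ)
    (hε0 : 0 < ε) (hε1 : ε < 1)
    (hp0 : 0 < p) (hp1 : p < ((q : ℝ) - 1) / (2 * q))
    (hps0 : 0 < pstar) (hps1 : pstar < ((q : ℝ) - 1) / q)
    (hsum : 2 * p + pstar + ε ≤ ((q : ℝ) - 1) / q)
    (hn : 0 < n)
    (θ : ℝ) (hθ : θ = ε ^ 2 / (9 * (q : ℝ) ^ 2))
    (t lam' lam pt' pt : ℝ)
    (ht0 : n * θ < t) (ht1 : t < n)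
    (hl'0 : 0 ≤ lam') (hl'l : lam' ≤ lam) (hll' : lam ≤ lam' + n * θ)
    (hl1 : lam ≤ n * pstar)
    (hm' : (t - n * θ) - lam' ≥ n * (alphaq q p pstar 0 - ε ^ 2 / 4))
    (hm : t - lam ∈ Set.Icc (n * (alphaq q p pstar 0 - ε ^ 2 / 4) + n * θ)
      (n * (1 - ((q : ℝ) / ((q : ℝ) - 1)) * pstar)))
    (hmono : (t - lam) * pt ≥ ((t - n * θ) - lam') * pt')
    (hpt' : pt' > phatT q p pstar ε n ((t - n * θ) - lam')) :
    pt > ptildeT q p pstar ε n t (t - lam) := by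
  have hq2 : (2 : ℝ) ≤ q := by exact_mod_cast hq
  have hq0 : (0 : ℝ) < q := by linarith
  have hεa : ε < alphaq q p pstar 0 := lt_alphaq_zero hq hε0 hsum
  have ha1 : alphaq q p pstar 0 ≤ 1 := alphaq_zero_le_one hq hp0.le hps0.le
  have hc0 : 0 ≤ ((q : ℝ) - 1) / (2 * q) := div_nonneg (by linarith) (by linarith)
  have hc : ((q : ℝ) - 1) / (2 * q) ≤ 1 / 2 := by
    rw [div_le_div_iff₀ (by positivity) (by norm_num)]
    linarith
  have hθ0 : 0 ≤ θ := by rw [hθ]; positivity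
  obtain ⟨x, hx⟩ : ∃ x, t - lam = n * x := ⟨(t - lam) / n, by field_simp⟩
  obtain ⟨y, hy⟩ : ∃ y, t - n * θ - lam' = n * y := ⟨(t - n * θ - lam') / n, by field_simp⟩
  obtain ⟨τ, rfl⟩ : ∃ τ, t = n * τ := ⟨t / n, by field_simp⟩
  have hnx : n * x / n = x := by field_simp
  have hny : n * y / n = y := by field_simp
  have hnθ : 0 ≤ n * θ := by positivity
  have hyx : y ≤ x := le_of_mul_le_mul_left (by linarith) hn
  have hxy : x ≤ y + θ := le_of_mul_le_mul_left (by linarith) hn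
  have hτ : y ≤ τ := le_of_mul_le_mul_left (by linarith) hn
  rw [hy] at hm' hmono hpt'
  rw [hx] at hmono ⊢
  have hya : alphaq q p pstar 0 - ε ^ 2 / 4 ≤ y := le_of_mul_le_mul_left hm' hn
  have hy0 : 0 < y := by nlinarith
  have hx0 : 0 < x := by linarith
  have hmass : y * pt' ≤ x * pt := le_of_mul_le_mul_left (by linarith) hn
  have hsplit : ∀ b : ℝ, ε ^ 2 / (9 * (q : ℝ) ^ 2 * b) = θ / b := fun b => by
    rw [hθ, div_div]
  have hstep : ((q : ℝ) - 1) / (2 * q) * (x - alphaq q p pstar 0) + (1 - τ) * θ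
      ≤ y * phatT q p pstar ε n (n * y) := by
    unfold phatT
    rw [alphaq_pbarT hq, pbarT_eq hq, hny, hsplit, hsplit]
    split_ifs with h
    · exact energy_le_of_lt hε0 hεa.le ha1 hc0 hc hθ0 hya (lt_of_mul_lt_mul_left h hn.le) hxy hτ
    · exact energy_le_of_pos hy0 hc0 hc hθ0 hxy hτ
  have hlt : y * phatT q p pstar ε n (n * y) < y * pt' := mul_lt_mul_of_pos_left hpt' hy0
  have htilde : x * ptildeT q p pstar ε n (n * τ) (n * x)
      = ((q : ℝ) - 1) / (2 * q) * (x - alphaq q p pstar 0) + (1 - τ) * θ := by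
    unfold ptildeT
    rw [alphaq_pbarT hq, pbarT_eq hq, hnx, mul_add, mul_div_cancel₀ _ hx0.ne', hθ]
    congr 1
    field_simp
  exact lt_of_mul_lt_mul_left (by linarith) hx0.le
end

section
/- Let q ≥ 2 be an integer and p̄ > 0 a real. The function x ↦ x·H_q(p̄/x) is strictly increasing on the interval [q·p̄/(q−1), ∞). -/
theorem mul_qEnt_div_eq (q : ℕ) {p x : ℝ} (hp : 0 < p) (hx : p < x) :
    x * qEnt q (p / x) = (p * Real.log (q - 1) - p * Real.log p +
      (x * Real.log x - (x - p) * Real.log (x - p))) / Real.log q := by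
  have hx0 : 0 < x := hp.trans hx
  have h : 1 - p / x = (x - p) / x := by field_simp
  rw [qEnt, h]
  simp only [Real.logb]
  rw [Real.log_div hp.ne' hx0.ne', Real.log_div (sub_pos.2 hx).ne' hx0.ne']
  field_simp
  ring

theorem strictMonoOn_mul_log_sub_mul_log {p : ℝ} (hp : 0 < p) :
    StrictMonoOn (fun x : ℝ => x * Real.log x - (x - p) * Real.log (x - p)) (Set.Ioi p) := by
  have hderiv : ∀ x ∈ Set.Ioi p, HasDerivAt
      (fun x : ℝ => x * Real.log x - (x - p) * Real.log (x - p))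
      (Real.log x - Real.log (x - p)) x := by
    intro x hx
    have h₁ := Real.hasDerivAt_mul_log (hp.trans hx).ne'
    have h₂ := (Real.hasDerivAt_mul_log (sub_pos.2 hx).ne').comp_sub_const x p
    exact (h₁.sub h₂).congr_deriv (by ring)
  refine strictMonoOn_of_deriv_pos (convex_Ioi p)
    (fun x hx => (hderiv x hx).continuousAt.continuousWithinAt) fun x hx => ?_
  rw [interior_Ioi] at hx
  rw [(hderiv x hx).deriv]
  exact sub_pos.2 (Real.log_lt_log (sub_pos.2 hx) (sub_lt_self x hp))

theorem stmt12 (q : ℕ) (hq : 2 ≤ q) (pbar : ℝ) (hpbar : 0 < pbar) :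
    StrictMonoOn (fun x : ℝ => x * qEnt q (pbar / x))
      (Set.Ici ((q : ℝ) * pbar / ((q : ℝ) - 1))) := by
  have hq1 : (1 : ℝ) < q := by exact_mod_cast hq
  have hlt : pbar < (q : ℝ) * pbar / ((q : ℝ) - 1) := by
    rw [lt_div_iff₀ (sub_pos.2 hq1)]
    linarith
  intro x hx y hy hxy
  have hx' : pbar < x := hlt.trans_le hx
  have hy' : pbar < y := hlt.trans_le hy
  have hmono := strictMonoOn_mul_log_sub_mul_log hpbar hx' hy' hxy
  simp only [mul_qEnt_div_eq q hpbar hx', mul_qEnt_div_eq q hpbar hy']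
  exact div_lt_div_of_pos_right (add_lt_add_right hmono _) (Real.log_pos hq1)
end

section
/- Define, for m ∈ (0, n], the function f(m) = (n/m)·( p + p⋆/2 − ((q−1)/(2q))·(1 − m/n) ) + n²·ε²/(9q²·m²) (this is the decoding reference trajectory value p̄/α + ε²/(9q²α²) expressed through m = t − λ_t, using α = m/n). Then f is strictly increasing on the interval [ n·(α_q(0) − ε²/4), n·(1 − (q/(q−1))·p⋆) ]. -/
theorem stmt13 (q : ℕ) (hq : 2 ≤ q) (ε p pstar n : ℝ)
    (hε0 : 0 < ε) (hε1 : ε < 1)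
    (hp0 : 0 < p) (hp1 : p < ((q : ℝ) - 1) / (2 * q))
    (hps0 : 0 < pstar) (hps1 : pstar < ((q : ℝ) - 1) / q)
    (hsum : 2 * p + pstar + ε ≤ ((q : ℝ) - 1) / q)
    (hn : 0 < n) :
    StrictMonoOn (fun m : ℝ =>
        (n / m) * (p + pstar / 2 - (((q : ℝ) - 1) / (2 * q)) * (1 - m / n)) +
          n ^ 2 * ε ^ 2 / (9 * (q : ℝ) ^ 2 * m ^ 2))
      (Set.Icc (n * (alphaq q p pstar 0 - ε ^ 2 / 4))
        (n * (1 - ((q : ℝ) / ((q : ℝ) - 1)) * pstar))) := by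
  have hq2 : (2 : ℝ) ≤ q := by exact_mod_cast hq
  have hq0 : (0 : ℝ) < q := by linarith
  have hq1 : (0 : ℝ) < (q : ℝ) - 1 := by linarith
  set c : ℝ := ((q : ℝ) - 1) / (2 * q) with hc
  have hc0 : 0 < c := by positivity
  have hc1 : c ≤ 1 / 2 := by
    rw [hc, div_le_iff₀ (by positivity)]
    linarith
  have hcq : ((q : ℝ) - 1) / q = 2 * c := by
    rw [hc]
    field_simp
  set D : ℝ := c - p - pstar / 2 with hD
  have hDε : ε / 2 ≤ D := by
    rw [hcq] at hsum
    linarith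
  have hα : alphaq q p pstar 0 = D / c := by
    rw [alphaq, hD, hc]
    field_simp
    ring
  have hαε : ε ≤ D / c := by
    rw [le_div_iff₀ hc0]
    nlinarith
  set θ : ℝ := ε ^ 2 / (9 * (q : ℝ) ^ 2) with hθ
  have hθ0 : 0 < θ := by positivity
  have hθ1 : θ ≤ ε ^ 2 / 36 := by
    rw [hθ]
    gcongr
    nlinarith
  have hlow : ∀ m, n * (alphaq q p pstar 0 - ε ^ 2 / 4) ≤ m → n * (3 * ε / 4) ≤ m := by
    intro m hm
    refine le_trans (mul_le_mul_of_nonneg_left ?_ hn.le) hm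
    rw [hα]
    nlinarith
  have hform : ∀ m, 0 < m →
      (n / m) * (p + pstar / 2 - c * (1 - m / n)) + n ^ 2 * ε ^ 2 / (9 * (q : ℝ) ^ 2 * m ^ 2) =
        c - D * (n / m) + θ * (n / m) ^ 2 := by
    intro m hm
    rw [hD, hθ]
    field_simp
    ring
  intro x hx y hy hxy
  have hx1 := hlow x hx.1
  have hx0 : 0 < x := lt_of_lt_of_le (by positivity) hx1
  have hy0 : 0 < y := hx0.trans hxy
  simp only [hform x hx0, hform y hy0]
  have huv : n / y < n / x := div_lt_div_of_pos_left hn hx0 hxy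
  have hu : ε * (n / x) ≤ 4 / 3 := by
    rw [← mul_div_assoc, div_le_iff₀ hx0]
    linarith
  have hv0 : 0 < n / y := by positivity
  generalize n / x = u at *
  generalize n / y = v at *
  have hkey : θ * (u + v) < D := by
    have h1 : θ * (u + v) ≤ ε ^ 2 / 36 * (2 * u) :=
      mul_le_mul hθ1 (by linarith) (by linarith) (by positivity)
    have h2 : ε * (ε * u) ≤ ε * (4 / 3) := mul_le_mul_of_nonneg_left hu hε0.le
    nlinarith
  nlinarith [mul_pos (sub_pos.2 huv) (sub_pos.2 hkey)]
end

section
/- Let q ≥ 2 and m, n ≥ 1 be integers, let ε ∈ (0,1), θ = ε²/(9q²), and let Δ > 0, R > 0 and p̂ ∈ [0, 1−1/q] be reals satisfying m·(1 − H_q(p̂)) − n·ε/4 ≥ n·R. Consider a random code in which each of M messages is assigned N codewords in {0,…,q−1}^m, where M ≤ q^{nR}, N ≤ q^{n·θ²/q²}, and all M·N codewords are drawn independently and uniformly at random from {0,…,q−1}^m. Then with probability at least 1 − q^{−Δ} over the choice of the code, for every word y ∈ {0,…,q−1}^m, the number of messages having at least one of their codewords within Hamming distance m·p̂ of y is at most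 L := (m + Δ)/( m·(1 − H_q(p̂)) − n·R − n·θ²/q² ). -/
open scoped Classical

/-- Fraction of functions that send every point of `S` into `B`, in cleared form. -/
theorem card_filter_forall_mem_mul {ι α : Type*} [Fintype ι] [Fintype α]
    (S : Finset ι) (B : Finset α) :
    ((Finset.univ.filter (fun f : ι → α => ∀ i ∈ S, f i ∈ B)).card : ℝ) *
        (Fintype.card α : ℝ) ^ S.card =
      (B.card : ℝ) ^ S.card * (Fintype.card (ι → α) : ℝ) := by
  have hset : (Finset.univ.filter (fun f : ι → α => ∀ i ∈ S, f i ∈ B)) =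
      Fintype.piFinset (fun i => if i ∈ S then B else Finset.univ) := by
    ext f
    simp only [Finset.mem_filter, Finset.mem_univ, true_and, Fintype.mem_piFinset]
    refine forall_congr' fun i => ?_
    split_ifs with h <;> simp [h]
  have hcard : Fintype.card ι = S.card + Sᶜ.card := (Finset.card_add_card_compl S).symm
  have hprod : ∏ i, (if i ∈ S then B else (Finset.univ : Finset α)).card =
      B.card ^ S.card * Fintype.card α ^ Sᶜ.card := by
    rw [← Finset.prod_mul_prod_compl S]
    congr 1
    · rw [Finset.prod_congr rfl (g := fun _ => B.card) (fun i hi => by simp [hi]),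
        Finset.prod_const]
    · rw [Finset.prod_congr rfl (g := fun _ => Fintype.card α)
        (fun i hi => by simp [Finset.mem_compl.mp hi]), Finset.prod_const]
  rw [hset, Fintype.card_piFinset, hprod, Fintype.card_fun, hcard]
  push_cast
  ring

/-- The generating function of Hamming distances to a fixed word. -/
theorem sum_pow_hammingDist (q m : ℕ) (hq : 1 ≤ q) (t : ℝ) (y : Fin m → Fin q) :
    ∑ x : Fin m → Fin q, t ^ hammingDist x y = (1 + ((q : ℝ) - 1) * t) ^ m := by
  have hterm : ∀ x : Fin m → Fin q,
      t ^ hammingDist x y = ∏ i, (if x i = y i then 1 else t) := by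
    intro x
    rw [Finset.prod_ite]
    simp [hammingDist]
  have hcoord : ∀ b : Fin q, ∑ a : Fin q, (if a = b then 1 else t) = 1 + ((q : ℝ) - 1) * t := by
    intro b
    rw [← Finset.add_sum_erase _ _ (Finset.mem_univ b)]
    rw [Finset.sum_congr rfl (g := fun _ => t)
      (fun a ha => by simp [Finset.ne_of_mem_erase ha])]
    simp [Finset.card_erase_of_mem, Nat.cast_sub hq]
  simp_rw [hterm]
  rw [← Fintype.prod_sum (fun (i : Fin m) (a : Fin q) => if a = y i then (1 : ℝ) else t)]
  simp [hcoord]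

/-- The volume of a Hamming ball of relative radius `p ≤ 1 - 1/q` is at most `q ^ (m H_q(p))`. -/
theorem card_hammingBall_le (q m : ℕ) (hq : 2 ≤ q) (p : ℝ)
    (hp : p ∈ Set.Icc (0 : ℝ) (1 - 1 / (q : ℝ))) (y : Fin m → Fin q) :
    ((Finset.univ.filter (fun x : Fin m → Fin q =>
        (hammingDist x y : ℝ) ≤ (m : ℝ) * p)).card : ℝ) ≤ (q : ℝ) ^ ((m : ℝ) * qEnt q p) := by
  have hq2 : (2 : ℝ) ≤ q := by exact_mod_cast hq
  have hq0 : (0 : ℝ) < q := by linarith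
  obtain ⟨hp0, hp1⟩ := hp
  rcases hp0.eq_or_lt with rfl | hpos
  · have hsub : (Finset.univ.filter (fun x : Fin m → Fin q =>
        (hammingDist x y : ℝ) ≤ (m : ℝ) * 0)) ⊆ {y} := by
      intro x hx
      simpa using hx
    have hc := Finset.card_le_card hsub
    simpa [qEnt] using hc
  have hinv : (0 : ℝ) < 1 / q := by positivity
  have h1p : 0 < 1 - p := by linarith
  have hq1 : (0 : ℝ) < q - 1 := by linarith
  set t : ℝ := p / ((q - 1) * (1 - p)) with ht
  have ht0 : 0 < t := by positivity
  have ht1 : t ≤ 1 := by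
    rw [ht, div_le_one (by positivity)]
    have : p * q ≤ (1 - 1 / q) * q := by gcongr
    have h2 : (1 - 1 / (q : ℝ)) * q = q - 1 := by field_simp
    nlinarith
  have hsum : 1 + ((q : ℝ) - 1) * t = (1 - p)⁻¹ := by
    rw [ht]; field_simp; ring
  have hmass : ((Finset.univ.filter (fun x : Fin m → Fin q =>
      (hammingDist x y : ℝ) ≤ (m : ℝ) * p)).card : ℝ) * t ^ ((m : ℝ) * p) ≤ ((1 - p)⁻¹) ^ m := by
    rw [← hsum, ← sum_pow_hammingDist q m (by omega) t y, ← nsmul_eq_mul]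
    refine (Finset.card_nsmul_le_sum _ (fun x => t ^ hammingDist x y) _ ?_).trans
      (Finset.sum_le_sum_of_subset_of_nonneg (Finset.filter_subset _ _)
        fun _ _ _ => by positivity)
    intro x hx
    rw [← Real.rpow_natCast]
    exact Real.rpow_le_rpow_of_exponent_ge ht0 ht1 (Finset.mem_filter.mp hx).2
  have hvol : (q : ℝ) ^ ((m : ℝ) * qEnt q p) * t ^ ((m : ℝ) * p) = ((1 - p)⁻¹) ^ m := by
    have hlq : Real.log q ≠ 0 := (Real.log_pos (by linarith)).ne'
    rw [← Real.rpow_natCast, Real.rpow_def_of_pos hq0, Real.rpow_def_of_pos ht0,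
      Real.rpow_def_of_pos (inv_pos.mpr h1p), ← Real.exp_add, ht,
      Real.log_div hpos.ne' (by positivity), Real.log_mul hq1.ne' h1p.ne', Real.log_inv]
    congr 1
    simp only [qEnt, Real.logb]
    field_simp
    ring
  rw [← hvol] at hmass
  exact le_of_mul_le_mul_right hmass (by positivity)

/-- Union bound: few functions `ι → α` hit a given set `B`. -/
theorem card_filter_exists_mem_mul_le {ι α : Type*} [Fintype ι] [Fintype α] (B : Finset α) :
    ((Finset.univ.filter (fun f : ι → α => ∃ i, f i ∈ B)).card : ℝ) * Fintype.card α ≤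
      Fintype.card ι * B.card * Fintype.card (ι → α) := by
  have hsub : (Finset.univ.filter (fun f : ι → α => ∃ i, f i ∈ B)) ⊆
      Finset.univ.biUnion fun i : ι =>
        Finset.univ.filter (fun f : ι → α => ∀ j ∈ ({i} : Finset ι), f j ∈ B) := by
    intro f hf
    simpa using hf
  have hle : ((Finset.univ.filter (fun f : ι → α => ∃ i, f i ∈ B)).card : ℝ) ≤
      ∑ i : ι, ((Finset.univ.filter
        (fun f : ι → α => ∀ j ∈ ({i} : Finset ι), f j ∈ B)).card : ℝ) := by
    exact_mod_cast (Finset.card_le_card hsub).trans Finset.card_biUnion_le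
  calc _ ≤ (∑ i : ι, ((Finset.univ.filter
        (fun f : ι → α => ∀ j ∈ ({i} : Finset ι), f j ∈ B)).card : ℝ)) * Fintype.card α := by
        gcongr
    _ = ∑ _i : ι, (B.card : ℝ) * Fintype.card (ι → α) := by
        rw [Finset.sum_mul]
        refine Finset.sum_congr rfl fun i _ => ?_
        simpa only [Finset.card_singleton, pow_one] using
          card_filter_forall_mem_mul ({i} : Finset ι) B
    _ = _ := by
        rw [Finset.sum_const, nsmul_eq_mul, Finset.card_univ]
        ring

/-- The density of the codeword assignments `Fin N → (Fin m → Fin q)` having some codeword within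
relative distance `p` of `y` is at most `N q ^ (-m (1 - H_q(p)))`. -/
theorem card_filter_exists_hammingDist_le (q m N : ℕ) (hq : 2 ≤ q) (p : ℝ)
    (hp : p ∈ Set.Icc (0 : ℝ) (1 - 1 / (q : ℝ))) (y : Fin m → Fin q) :
    ((Finset.univ.filter (fun f : Fin N → (Fin m → Fin q) =>
        ∃ b, (hammingDist (f b) y : ℝ) ≤ (m : ℝ) * p)).card : ℝ) ≤
      N * (q : ℝ) ^ (-((m : ℝ) * (1 - qEnt q p))) *
        Fintype.card (Fin N → (Fin m → Fin q)) := by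
  have hq0 : (0 : ℝ) < q := by exact_mod_cast (by omega : 0 < q)
  have hball := card_hammingBall_le q m hq p hp y
  have hw : (Fintype.card (Fin m → Fin q) : ℝ) = (q : ℝ) ^ (m : ℝ) := by simp
  have h := card_filter_exists_mem_mul_le (ι := Fin N)
    (Finset.univ.filter (fun x : Fin m → Fin q => (hammingDist x y : ℝ) ≤ (m : ℝ) * p))
  simp only [Finset.mem_filter, Finset.mem_univ, true_and] at h
  rw [hw, Fintype.card_fin] at h
  have hsplit : (q : ℝ) ^ ((m : ℝ) * qEnt q p) =
      (q : ℝ) ^ (-((m : ℝ) * (1 - qEnt q p))) * (q : ℝ) ^ (m : ℝ) := by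
    rw [← Real.rpow_add hq0]; congr 1; ring
  rw [hsplit] at hball
  refine le_of_mul_le_mul_right ?_ (Real.rpow_pos_of_pos hq0 (m : ℝ))
  calc _ ≤ (N : ℝ) * (Finset.univ.filter (fun x : Fin m → Fin q =>
        (hammingDist x y : ℝ) ≤ (m : ℝ) * p)).card *
        Fintype.card (Fin N → (Fin m → Fin q)) := by convert h
    _ ≤ N * ((q : ℝ) ^ (-((m : ℝ) * (1 - qEnt q p))) * (q : ℝ) ^ (m : ℝ)) *
        Fintype.card (Fin N → (Fin m → Fin q)) := by gcongr
    _ = _ := by ring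

/-- Union bound over sets of size `k`: if each `G y` has density at most `r` in `α`, then few
functions `ι → α` send at least `k` points into a common `G y`. -/
theorem card_filter_exists_le_card_filter_le {ι α β : Type*} [Fintype ι] [Fintype α]
    [Nonempty α] [Fintype β] (G : β → Finset α) (k : ℕ) (r : ℝ)
    (hG : ∀ y, ((G y).card : ℝ) ≤ r * Fintype.card α) :
    ((Finset.univ.filter (fun f : ι → α =>
        ∃ y, k ≤ (Finset.univ.filter (fun i => f i ∈ G y)).card)).card : ℝ) ≤
      Fintype.card β * (Fintype.card ι * r) ^ k * Fintype.card (ι → α) := by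
  rcases isEmpty_or_nonempty β with hβ | ⟨⟨y₀⟩⟩
  · simp
  have hα : 0 < Fintype.card α := Fintype.card_pos
  have hα' : (0 : ℝ) < Fintype.card α := by exact_mod_cast hα
  have hr : 0 ≤ r := nonneg_of_mul_nonneg_left ((Nat.cast_nonneg _).trans (hG y₀)) hα'
  have hsub : (Finset.univ.filter (fun f : ι → α =>
        ∃ y, k ≤ (Finset.univ.filter (fun i => f i ∈ G y)).card)) ⊆
      (Finset.univ ×ˢ Finset.univ.powersetCard k).biUnion fun z : β × Finset ι =>
        Finset.univ.filter (fun f : ι → α => ∀ i ∈ z.2, f i ∈ G z.1) := by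
    intro f hf
    obtain ⟨y, hy⟩ := (Finset.mem_filter.mp hf).2
    obtain ⟨S, hS, hSk⟩ := Finset.exists_subset_card_eq hy
    refine Finset.mem_biUnion.mpr ⟨(y, S), by simp [hSk], ?_⟩
    refine Finset.mem_filter.mpr ⟨Finset.mem_univ _, fun i hi => ?_⟩
    exact (Finset.mem_filter.mp (hS hi)).2
  have hle := (Finset.card_le_card hsub).trans Finset.card_biUnion_le
  have hle' : ((Finset.univ.filter (fun f : ι → α =>
        ∃ y, k ≤ (Finset.univ.filter (fun i => f i ∈ G y)).card)).card : ℝ) ≤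
      ∑ z ∈ (Finset.univ ×ˢ Finset.univ.powersetCard k : Finset (β × Finset ι)),
        ((Finset.univ.filter (fun f : ι → α => ∀ i ∈ z.2, f i ∈ G z.1)).card : ℝ) := by
    exact_mod_cast hle
  have hz : ∀ z ∈ (Finset.univ ×ˢ Finset.univ.powersetCard k : Finset (β × Finset ι)),
      ((Finset.univ.filter (fun f : ι → α => ∀ i ∈ z.2, f i ∈ G z.1)).card : ℝ) ≤
        r ^ k * Fintype.card (ι → α) := by
    rintro ⟨y, S⟩ hyS
    have hS : S.card = k := by simpa using hyS
    have h := card_filter_forall_mem_mul S (G y)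
    rw [hS] at h
    refine le_of_mul_le_mul_right (h.le.trans ?_) (pow_pos hα' k)
    calc ((G y).card : ℝ) ^ k * Fintype.card (ι → α)
        ≤ (r * Fintype.card α) ^ k * Fintype.card (ι → α) := by gcongr; exact hG y
      _ = _ := by rw [mul_pow]; ring
  refine (hle'.trans (Finset.sum_le_card_nsmul _ _ _ hz)).trans ?_
  rw [nsmul_eq_mul, Finset.card_product, Finset.card_powersetCard, Finset.card_univ,
    Finset.card_univ, Nat.cast_mul, mul_pow]
  have hch : ((Fintype.card ι).choose k : ℝ) ≤ (Fintype.card ι : ℝ) ^ k := by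
    exact_mod_cast Nat.choose_le_pow _ _
  calc _ ≤ (Fintype.card β : ℝ) * (Fintype.card ι : ℝ) ^ k *
        (r ^ k * Fintype.card (ι → α)) := by gcongr
    _ = _ := by ring


/-- Lower bound for the number of functions `ι → α` for which every `y` is related to at most `L`
of the values, when each `y` is related to a fraction at most `r` of `α`. -/
theorem le_card_filter_forall_card_filter_le {ι α β : Type*} [Fintype ι] [Fintype α]
    [Nonempty α] [Fintype β] (Q : α → β → Prop) (L r : ℝ) (hL : 0 ≤ L)
    (hQ : ∀ y, ((Finset.univ.filter (fun x => Q x y)).card : ℝ) ≤ r * Fintype.card α) :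
    (1 - Fintype.card β * (Fintype.card ι * r) ^ (⌊L⌋₊ + 1)) * (Fintype.card (ι → α) : ℝ) ≤
      ((Finset.univ.filter (fun f : ι → α =>
        ∀ y, ((Finset.univ.filter (fun i => Q (f i) y)).card : ℝ) ≤ L)).card : ℝ) := by
  have hbad := card_filter_exists_le_card_filter_le (ι := ι)
    (fun y => Finset.univ.filter (fun x => Q x y)) (⌊L⌋₊ + 1) r hQ
  set good := Finset.univ.filter (fun f : ι → α =>
    ∀ y, ((Finset.univ.filter (fun i => Q (f i) y)).card : ℝ) ≤ L) with hgood
  have hcompl : goodᶜ ⊆ Finset.univ.filter (fun f : ι → α => ∃ y, ⌊L⌋₊ + 1 ≤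
      (Finset.univ.filter (fun i => f i ∈ Finset.univ.filter (fun x => Q x y))).card) := by
    intro f hf
    simp only [hgood, Finset.mem_compl, Finset.mem_filter, Finset.mem_univ, true_and,
      not_forall, not_le] at hf
    obtain ⟨y, hy⟩ := hf
    simp only [Finset.mem_filter, Finset.mem_univ, true_and]
    exact ⟨y, (Nat.floor_lt hL).mpr hy⟩
  have hcard : (good.card : ℝ) + (goodᶜ.card : ℝ) = Fintype.card (ι → α) := by
    exact_mod_cast Finset.card_add_card_compl good
  have hc : (goodᶜ.card : ℝ) ≤ _ := (Nat.cast_le.mpr (Finset.card_le_card hcompl)).trans hbad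
  linarith

theorem stmt17 (q m n M N : ℕ) (hq : 2 ≤ q) (hm : 1 ≤ m) (hn : 1 ≤ n)
    (ε : ℝ) (hε0 : 0 < ε) (hε1 : ε < 1)
    (θ : ℝ) (hθ : θ = ε ^ 2 / (9 * (q : ℝ) ^ 2))
    (Δ R phat : ℝ) (hΔ : 0 < Δ) (hR : 0 < R)
    (hphat : phat ∈ Set.Icc (0 : ℝ) (1 - 1 / (q : ℝ)))
    (hlist : (m : ℝ) * (1 - qEnt q phat) - n * ε / 4 ≥ n * R)
    (hM : (M : ℝ) ≤ (q : ℝ) ^ ((n : ℝ) * R))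
    (hN : (N : ℝ) ≤ (q : ℝ) ^ ((n : ℝ) * θ ^ 2 / (q : ℝ) ^ 2)) :
    (1 - (q : ℝ) ^ (-Δ)) * (Fintype.card (Fin M → Fin N → (Fin m → Fin q)) : ℝ) ≤
      ((Finset.univ.filter (fun c : Fin M → Fin N → (Fin m → Fin q) =>
          ∀ y : Fin m → Fin q,
            ((Finset.univ.filter (fun a : Fin M =>
                ∃ b : Fin N, (hammingDist (c a b) y : ℝ) ≤ (m : ℝ) * phat)).card : ℝ) ≤
              ((m : ℝ) + Δ) /
                ((m : ℝ) * (1 - qEnt q phat) - n * R - n * θ ^ 2 / (q : ℝ) ^ 2))).card : ℝ) := by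
  have hq2 : (2 : ℝ) ≤ q := by exact_mod_cast hq
  have hq0 : (0 : ℝ) < q := by linarith
  have hn1 : (1 : ℝ) ≤ n := by exact_mod_cast hn
  have : Nonempty (Fin q) := ⟨⟨0, by omega⟩⟩
  set D : ℝ := (m : ℝ) * (1 - qEnt q phat) - n * R - n * θ ^ 2 / (q : ℝ) ^ 2 with hD
  have hD0 : 0 < D := by
    have hθ0 : 0 ≤ θ := by rw [hθ]; positivity
    have hθε : θ ≤ ε / 36 := by
      rw [hθ, div_le_div_iff₀ (by positivity) (by norm_num)]
      nlinarith [mul_pos hε0 (sub_pos.mpr hε1),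
        mul_le_mul_of_nonneg_left (show (4 : ℝ) ≤ (q : ℝ) ^ 2 by nlinarith) hε0.le]
    have hθ2 : θ ^ 2 / (q : ℝ) ^ 2 ≤ ε / 36 :=
      (div_le_self (sq_nonneg θ) (by nlinarith)).trans (by nlinarith)
    have h1 : (n : ℝ) * θ ^ 2 / (q : ℝ) ^ 2 ≤ n * (ε / 36) := by
      rw [mul_div_assoc]; gcongr
    have h2 : 0 < (n : ℝ) * ε := by positivity
    rw [hD]; linarith
  set L : ℝ := ((m : ℝ) + Δ) / D with hL
  have hL0 : 0 ≤ L := by positivity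
  set k : ℕ := ⌊L⌋₊ + 1 with hk
  have hLk : L < k := by rw [hk]; exact_mod_cast Nat.lt_floor_add_one L
  set H : ℝ := qEnt q phat with hH
  set r : ℝ := N * (q : ℝ) ^ (-((m : ℝ) * (1 - H))) with hr
  have hMr : (M : ℝ) * r ≤ (q : ℝ) ^ (-D) := by
    calc (M : ℝ) * r ≤ (q : ℝ) ^ ((n : ℝ) * R) * ((q : ℝ) ^ ((n : ℝ) * θ ^ 2 / (q : ℝ) ^ 2) *
          (q : ℝ) ^ (-((m : ℝ) * (1 - H)))) := by rw [hr]; gcongr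
      _ = _ := by
        rw [← Real.rpow_add hq0, ← Real.rpow_add hq0, hD]; congr 1; ring
  have hprob : (Fintype.card (Fin m → Fin q) : ℝ) * (Fintype.card (Fin M) * r) ^ k ≤
      (q : ℝ) ^ (-Δ) := by
    have hw : (Fintype.card (Fin m → Fin q) : ℝ) = (q : ℝ) ^ (m : ℝ) := by simp
    rw [hw, Fintype.card_fin]
    calc (q : ℝ) ^ (m : ℝ) * (M * r) ^ k ≤ (q : ℝ) ^ (m : ℝ) * ((q : ℝ) ^ (-D)) ^ k := by
          gcongr
      _ = (q : ℝ) ^ ((m : ℝ) + -D * k) := by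
          rw [← Real.rpow_natCast, ← Real.rpow_mul hq0.le, ← Real.rpow_add hq0]
      _ ≤ (q : ℝ) ^ (-Δ) := by
          refine Real.rpow_le_rpow_of_exponent_le (by linarith) ?_
          have := (div_lt_iff₀ hD0).mp hLk
          linarith
  have hdens : ∀ y : Fin m → Fin q, ((Finset.univ.filter (fun f : Fin N → (Fin m → Fin q) =>
      ∃ b, (hammingDist (f b) y : ℝ) ≤ (m : ℝ) * phat)).card : ℝ) ≤
        r * Fintype.card (Fin N → (Fin m → Fin q)) :=
    card_filter_exists_hammingDist_le q m N hq phat hphat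
  have hgood := le_card_filter_forall_card_filter_le (ι := Fin M)
    (fun (f : Fin N → (Fin m → Fin q)) (y : Fin m → Fin q) =>
      ∃ b, (hammingDist (f b) y : ℝ) ≤ (m : ℝ) * phat) L r hL0
    (fun y => by convert hdens y)
  refine le_trans ?_ (hgood.trans (le_of_eq ?_))
  · refine mul_le_mul (by linarith) (le_of_eq ?_) (Nat.cast_nonneg _) ?_
    · congr!
    · have hq1 : (q : ℝ) ^ (-Δ) ≤ 1 :=
        Real.rpow_le_one_of_one_le_of_nonpos (by linarith) (by linarith)
      linarith
  · congr!
end
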